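/- Let a, b, c, k be positive integers. If every type-1 configuration of [a,b,c] admits a proper k-coloring, then every type-3 configuration of [a,b,c] admits a proper 6k-coloring. -/

import Mathlib

/-- A cuboid with integer root and integer dimensions. -/
structure Cuboid where
  root : ℤ × ℤ × ℤ
  dims : ℤ × ℤ × ℤ
deriving DecidableEq

namespace Cuboid

/-- The dimensions are positive. -/
def valid (C : Cuboid) : Prop :=
  0 < C.dims.1 ∧ 0 < C.dims.2.1 ∧ 0 < C.dims.2.2

/-- The closed cuboid `[x,x+a] × [y,y+b] × [z,z+c] ⊆ ℝ³`. -/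
def toSet (C : Cuboid) : Set (ℝ × ℝ × ℝ) :=
  {p | (C.root.1 : ℝ) ≤ p.1 ∧ p.1 ≤ C.root.1 + C.dims.1 ∧
       (C.root.2.1 : ℝ) ≤ p.2.1 ∧ p.2.1 ≤ C.root.2.1 + C.dims.2.1 ∧
       (C.root.2.2 : ℝ) ≤ p.2.2 ∧ p.2.2 ≤ C.root.2.2 + C.dims.2.2}

/-- The open cuboid `(x,x+a) × (y,y+b) × (z,z+c) ⊆ ℝ³` (the interior). -/
def inte (C : Cuboid) : Set (ℝ × ℝ × ℝ) :=
  {p | (C.root.1 : ℝ) < p.1 ∧ p.1 < C.root.1 + C.dims.1 ∧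
       (C.root.2.1 : ℝ) < p.2.1 ∧ p.2.1 < C.root.2.1 + C.dims.2.1 ∧
       (C.root.2.2 : ℝ) < p.2.2 ∧ p.2.2 < C.root.2.2 + C.dims.2.2}

/-- The set `(ℤ×ℤ×ℝ) ∪ (ℤ×ℝ×ℤ) ∪ (ℝ×ℤ×ℤ)` of grid lines. -/
def grid : Set (ℝ × ℝ × ℝ) :=
  {p | ((∃ m : ℤ, p.1 = m) ∧ (∃ n : ℤ, p.2.1 = n)) ∨
       ((∃ m : ℤ, p.1 = m) ∧ (∃ n : ℤ, p.2.2 = n)) ∨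
       ((∃ m : ℤ, p.2.1 = m) ∧ (∃ n : ℤ, p.2.2 = n))}

/-- Two cuboids collide when their interiors intersect. -/
def Collide (C D : Cuboid) : Prop := (C.inte ∩ D.inte).Nonempty

/-- Two cuboids touch when their interiors are disjoint but their intersection
contains a point outside the grid lines (i.e. it is a non-degenerate rectangle). -/
def Touch (C D : Cuboid) : Prop :=
  ¬ Collide C D ∧ ∃ p ∈ C.toSet ∩ D.toSet, p ∉ grid

end Cuboid

/-- A configuration: a finite family of valid pairwise non-colliding cuboids. -/
def IsConfig (F : Finset Cuboid) : Prop :=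
  (∀ C ∈ F, C.valid) ∧ ∀ C ∈ F, ∀ D ∈ F, C ≠ D → ¬ Cuboid.Collide C D

/-- A type-1 configuration of `[a,b,c]`: every cuboid has dimensions exactly `(a,b,c)`. -/
def Type1 (a b c : ℕ) (F : Finset Cuboid) : Prop :=
  ∀ C ∈ F, C.dims = ((a : ℤ), (b : ℤ), (c : ℤ))

/-- A type-2 configuration of `[a,b,c]`: every cuboid has dimensions `(a,b,c)` or `(b,a,c)`. -/
def Type2 (a b c : ℕ) (F : Finset Cuboid) : Prop :=
  ∀ C ∈ F, C.dims = ((a : ℤ), (b : ℤ), (c : ℤ)) ∨ C.dims = ((b : ℤ), (a : ℤ), (c : ℤ))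

/-- A type-3 configuration of `[a,b,c]`: every cuboid's dimensions are a permutation of `(a,b,c)`. -/
def Type3 (a b c : ℕ) (F : Finset Cuboid) : Prop :=
  ∀ C ∈ F, C.dims = ((a : ℤ), (b : ℤ), (c : ℤ)) ∨ C.dims = ((a : ℤ), (c : ℤ), (b : ℤ)) ∨
    C.dims = ((b : ℤ), (a : ℤ), (c : ℤ)) ∨ C.dims = ((b : ℤ), (c : ℤ), (a : ℤ)) ∨
    C.dims = ((c : ℤ), (a : ℤ), (b : ℤ)) ∨ C.dims = ((c : ℤ), (b : ℤ), (a : ℤ))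

/-- A proper `k`-coloring of a configuration: touching cuboids get distinct colors. -/
def ProperColoring (k : ℕ) (F : Finset Cuboid) : Prop :=
  ∃ κ : Cuboid → Fin k, ∀ C ∈ F, ∀ D ∈ F, Cuboid.Touch C D → κ C ≠ κ D

/-- Every type-1 configuration of `[a,b,c]` admits a proper `k`-coloring. -/
def Type1Colorable (k a b c : ℕ) : Prop :=
  ∀ F : Finset Cuboid, IsConfig F → Type1 a b c F → ProperColoring k F

namespace Cuboid

/-- Exchange the first two coordinates of a triple. -/
def swapXY {α : Type*} (p : α × α × α) : α × α × α := (p.2.1, p.1, p.2.2)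

/-- Exchange the last two coordinates of a triple. -/
def swapYZ {α : Type*} (p : α × α × α) : α × α × α := (p.1, p.2.2, p.2.1)

/-- A cuboid symmetry induced by an involution of the ambient space preserves touching and
colliding, hence turns a coloring result for one shape into one for the transformed shape. -/
theorem type1Colorable_of_involutive {k a b c a' b' c' : ℕ} (s : Cuboid → Cuboid)
    (σ : ℝ × ℝ × ℝ → ℝ × ℝ × ℝ) (hs : Function.Involutive s) (hσ : Function.Involutive σ)
    (hvalid : ∀ C, C.valid → (s C).valid)
    (hinte : ∀ C p, p ∈ C.inte → σ p ∈ (s C).inte)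
    (hset : ∀ C p, p ∈ C.toSet → σ p ∈ (s C).toSet)
    (hgrid : ∀ p, p ∈ grid → σ p ∈ grid)
    (hdims : ∀ C : Cuboid, C.dims = ((a' : ℤ), (b' : ℤ), (c' : ℤ)) →
      (s C).dims = ((a : ℤ), (b : ℤ), (c : ℤ)))
    (h : Type1Colorable k a b c) : Type1Colorable k a' b' c' := by
  have hcollide : ∀ C D, Collide C D → Collide (s C) (s D) := by
    rintro C D ⟨p, hC, hD⟩
    exact ⟨σ p, hinte C p hC, hinte D p hD⟩
  have hcollide' : ∀ C D, Collide (s C) (s D) → Collide C D := by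
    intro C D hCD
    simpa only [hs C, hs D] using hcollide _ _ hCD
  intro F hF hF1
  obtain ⟨κ, hκ⟩ := h (F.image s)
    (by
      constructor
      · simp only [Finset.forall_mem_image]
        exact fun C hC => hvalid C (hF.1 C hC)
      · simp only [Finset.forall_mem_image]
        exact fun C hC D hD hne hcol =>
          hF.2 C hC D hD (fun e => hne (congrArg s e)) (hcollide' C D hcol))
    (by
      simp only [Type1, Finset.forall_mem_image]
      exact fun C hC => hdims C (hF1 C hC))
  refine ⟨fun C => κ (s C), fun C hC D hD ⟨hnc, p, ⟨hpC, hpD⟩, hp⟩ => ?_⟩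
  refine hκ _ (Finset.mem_image_of_mem s hC) _ (Finset.mem_image_of_mem s hD)
    ⟨fun hcol => hnc (hcollide' C D hcol), σ p, ⟨hset C p hpC, hset D p hpD⟩, fun hg => hp ?_⟩
  simpa only [hσ p] using hgrid _ hg

theorem type1Colorable_swapXY {k a b c : ℕ} (h : Type1Colorable k a b c) :
    Type1Colorable k b a c := by
  refine type1Colorable_of_involutive (fun C => ⟨swapXY C.root, swapXY C.dims⟩) swapXY
    (fun _ => rfl) (fun _ => rfl) ?_ ?_ ?_ ?_ ?_ h
  · rintro C ⟨h1, h2, h3⟩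
    exact ⟨h2, h1, h3⟩
  · rintro C p ⟨h1, h2, h3, h4, h5, h6⟩
    exact ⟨h3, h4, h1, h2, h5, h6⟩
  · rintro C p ⟨h1, h2, h3, h4, h5, h6⟩
    exact ⟨h3, h4, h1, h2, h5, h6⟩
  · rintro p (⟨h1, h2⟩ | ⟨h1, h2⟩ | ⟨h1, h2⟩)
    · exact Or.inl ⟨h2, h1⟩
    · exact Or.inr (Or.inr ⟨h1, h2⟩)
    · exact Or.inr (Or.inl ⟨h1, h2⟩)
  · intro C hC
    simp only [hC, swapXY]

theorem type1Colorable_swapYZ {k a b c : ℕ} (h : Type1Colorable k a b c) :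
    Type1Colorable k a c b := by
  refine type1Colorable_of_involutive (fun C => ⟨swapYZ C.root, swapYZ C.dims⟩) swapYZ
    (fun _ => rfl) (fun _ => rfl) ?_ ?_ ?_ ?_ ?_ h
  · rintro C ⟨h1, h2, h3⟩
    exact ⟨h1, h3, h2⟩
  · rintro C p ⟨h1, h2, h3, h4, h5, h6⟩
    exact ⟨h1, h2, h5, h6, h3, h4⟩
  · rintro C p ⟨h1, h2, h3, h4, h5, h6⟩
    exact ⟨h1, h2, h5, h6, h3, h4⟩
  · rintro p (⟨h1, h2⟩ | ⟨h1, h2⟩ | ⟨h1, h2⟩)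
    · exact Or.inr (Or.inl ⟨h1, h2⟩)
    · exact Or.inl ⟨h1, h2⟩
    · exact Or.inr (Or.inr ⟨h2, h1⟩)
  · intro C hC
    simp only [hC, swapYZ]

end Cuboid

/-- If the shapes occurring in a configuration are among `n` shapes each of which is
`k`-colorable, then the configuration is `n * k`-colorable. -/
theorem ProperColoring.of_shapes {n k : ℕ} (d : Fin n → ℕ × ℕ × ℕ)
    (hd : ∀ i, Type1Colorable k (d i).1 (d i).2.1 (d i).2.2)
    {F : Finset Cuboid} (hF : IsConfig F) (ι : Cuboid → Fin n)
    (hι : ∀ C ∈ F, C.dims = (((d (ι C)).1 : ℤ), ((d (ι C)).2.1 : ℤ), ((d (ι C)).2.2 : ℤ))) :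
    ProperColoring (n * k) F := by
  have hcol : ∀ i, ProperColoring k (F.filter fun C => ι C = i) := by
    refine fun i => hd i _ ⟨fun C hC => hF.1 C (Finset.mem_filter.1 hC).1, fun C hC D hD =>
      hF.2 C (Finset.mem_filter.1 hC).1 D (Finset.mem_filter.1 hD).1⟩ fun C hC => ?_
    obtain ⟨hCF, rfl⟩ := Finset.mem_filter.1 hC
    exact hι C hCF
  choose κ hκ using hcol
  refine ⟨fun C => finProdFinEquiv (ι C, κ (ι C) C), fun C hC D hD ht heq => ?_⟩
  obtain ⟨h1, h2⟩ := Prod.mk.inj (finProdFinEquiv.injective heq)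
  rw [← h1] at h2
  exact hκ (ι C) C (Finset.mem_filter.2 ⟨hC, rfl⟩) D (Finset.mem_filter.2 ⟨hD, h1.symm⟩) ht h2

/-- If every type-1 configuration of `[a,b,c]` is properly `k`-colorable, then every
type-3 configuration of `[a,b,c]` is properly `6k`-colorable. -/
theorem type3_coloring_of_type1
    (a b c k : ℕ) (ha : 0 < a) (hb : 0 < b) (hc : 0 < c) (hk : 0 < k)
    (h : ∀ F : Finset Cuboid, IsConfig F → Type1 a b c F → ProperColoring k F) :
    ∀ F : Finset Cuboid, IsConfig F → Type3 a b c F → ProperColoring (6 * k) F := by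
  intro F hF hF3
  have habc : Type1Colorable k a b c := h
  have hacb := Cuboid.type1Colorable_swapYZ habc
  have hbac := Cuboid.type1Colorable_swapXY habc
  have hbca := Cuboid.type1Colorable_swapYZ hbac
  have hcab := Cuboid.type1Colorable_swapXY hacb
  have hcba := Cuboid.type1Colorable_swapYZ hcab
  let d : Fin 6 → ℕ × ℕ × ℕ :=
    ![(a, b, c), (a, c, b), (b, a, c), (b, c, a), (c, a, b), (c, b, a)]
  have hd : ∀ i, Type1Colorable k (d i).1 (d i).2.1 (d i).2.2 := by
    intro i
    fin_cases i
    exacts [habc, hacb, hbac, hbca, hcab, hcba]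
  have hex : ∀ C : Cuboid, ∃ i : Fin 6, C ∈ F →
      C.dims = (((d i).1 : ℤ), ((d i).2.1 : ℤ), ((d i).2.2 : ℤ)) := by
    intro C
    by_cases hC : C ∈ F
    · rcases hF3 C hC with e | e | e | e | e | e
      exacts [⟨0, fun _ => e⟩, ⟨1, fun _ => e⟩, ⟨2, fun _ => e⟩, ⟨3, fun _ => e⟩,
        ⟨4, fun _ => e⟩, ⟨5, fun _ => e⟩]
    · exact ⟨0, fun hC' => absurd hC' hC⟩
  choose ι hι using hex
  exact ProperColoring.of_shapes d hd hF ι hι
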